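/- arXiv:1912.07945 — 6 statements merged into one kernel-verified Lean document; each statement's English description precedes it below -/
import Mathlib

section
/- For every natural number n, the convolution ∑_{k=0}^n p(k)·p(n−k) equals (α/A)^2 · (2α^n/(n+2)) · H_{n+1}. (This is the probability mass function of the sum L(2) of two independent copies of the logarithmic series random variable, expressed through harmonic numbers.) -/
/-- Partial fractions and reflection turn the convolution of reciprocals into a harmonic sum. -/
lemma sum_range_inv_mul_inv_reflect (n : ℕ) :
    ∑ k ∈ Finset.range (n + 1), 1 / (((k : ℝ) + 1) * (n - k + 1))
      = 2 / (n + 2) * ∑ j ∈ Finset.range (n + 1), (1 : ℝ) / (j + 1) := by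
  have hreflect : ∑ k ∈ Finset.range (n + 1), (1 : ℝ) / (n - k + 1)
      = ∑ j ∈ Finset.range (n + 1), (1 : ℝ) / (j + 1) := by
    rw [← Finset.sum_range_reflect]
    refine Finset.sum_congr rfl fun k hk => ?_
    have hkn : k ≤ n := Nat.lt_succ_iff.mp (Finset.mem_range.mp hk)
    rw [Nat.add_sub_cancel, Nat.cast_sub hkn, sub_sub_cancel]
  have hsplit : ∑ k ∈ Finset.range (n + 1), 1 / (((k : ℝ) + 1) * (n - k + 1))
      = ∑ k ∈ Finset.range (n + 1),
          1 / ((n : ℝ) + 2) * (1 / ((k : ℝ) + 1) + 1 / (n - k + 1)) := by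
    refine Finset.sum_congr rfl fun k hk => ?_
    have hkn : (k : ℝ) ≤ n := by exact_mod_cast Nat.lt_succ_iff.mp (Finset.mem_range.mp hk)
    have hk1 : (k : ℝ) + 1 ≠ 0 := by positivity
    have hnk : (n : ℝ) - k + 1 ≠ 0 := by linarith
    have hn2 : (n : ℝ) + 2 ≠ 0 := by positivity
    field_simp
    ring
  rw [hsplit, ← Finset.mul_sum, Finset.sum_add_distrib, hreflect]
  ring

/-- The convolution of the logarithmic series p.m.f. with itself:
`∑_{k=0}^n p(k)·p(n−k) = (α/A)² · (2αⁿ/(n+2)) · H_{n+1}`. -/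
theorem logSeries_convolution_two (α : ℝ) (hα0 : 0 < α) (hα1 : α < 1)
    (A : ℝ) (hA : A = -Real.log (1 - α)) (n : ℕ) :
    ∑ k ∈ Finset.range (n + 1),
        (α ^ (k + 1) / (A * (k + 1))) * (α ^ (n - k + 1) / (A * (n - k + 1)))
      = (α / A) ^ 2 * (2 * α ^ n / (n + 2)) *
        ∑ j ∈ Finset.range (n + 1), (1 : ℝ) / (j + 1) := by
  have hfactor : ∀ k ∈ Finset.range (n + 1),
      (α ^ (k + 1) / (A * (k + 1))) * (α ^ (n - k + 1) / (A * (n - k + 1)))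
        = (α / A) ^ 2 * α ^ n * (1 / (((k : ℝ) + 1) * (n - k + 1))) := by
    intro k hk
    have hkn : k ≤ n := Nat.lt_succ_iff.mp (Finset.mem_range.mp hk)
    have hpow : α ^ (k + 1) * α ^ (n - k + 1) = α ^ 2 * α ^ n := by
      rw [← pow_add, ← pow_add]
      congr 1
      omega
    rw [div_mul_div_comm, hpow, div_pow, div_mul_eq_mul_div, div_mul_div_comm, mul_one]
    congr 1
    ring
  rw [Finset.sum_congr rfl hfactor, ← Finset.mul_sum, sum_range_inv_mul_inv_reflect]
  ring
end

section
/- For every real β > 0 and every natural number n ≥ 1, the Lévy measure of the Negative-Binomial process X directed by a Gamma subordinator satisfies Π_Y(n) = ∫_0^∞ P(X(u)=n) · e^{−u/β} du/u = (α^n/n!) · ∑_{k=1}^n |s(n,k)| · (k−1)! · (β/(1+Aβ))^k, where P(X(u)=n) = e^{−Au}·[u]_{n↑}·α^n/n! is the transition probability of the Negative-Binomial process and e^{−u/β}du/u is the Lévy measure of the Gamma subordinator; the integral is over (0,∞). -/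
open MeasureTheory Set in
/-- The integrands `u ^ m * exp (-(r * u))` of the Gamma integrals are integrable on `(0, ∞)`. -/
theorem integrableOn_pow_mul_exp_neg_mul_Ioi (m : ℕ) {r : ℝ} (hr : 0 < r) :
    IntegrableOn (fun u : ℝ => u ^ m * Real.exp (-(r * u))) (Ioi 0) := by
  have hm : (-1 : ℝ) < m := neg_one_lt_zero.trans_le m.cast_nonneg
  simpa using integrableOn_rpow_mul_exp_neg_mul_rpow hm one_pos hr

open MeasureTheory Set in
/-- The Gamma integral at a natural number exponent. -/
theorem integral_pow_mul_exp_neg_mul_Ioi (m : ℕ) {r : ℝ} (hr : 0 < r) :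
    ∫ u in Ioi (0 : ℝ), u ^ m * Real.exp (-(r * u)) = (m.factorial : ℝ) * (1 / r) ^ (m + 1) := by
  have h := Real.integral_rpow_mul_exp_neg_mul_Ioi (a := (m : ℝ) + 1) (by positivity) hr
  simp only [add_sub_cancel_right, Real.rpow_natCast, Real.Gamma_nat_eq_factorial] at h
  rw [h, mul_comm, ← Real.rpow_natCast, Nat.cast_add_one]

/-- The ascending factorial of positive order, expanded in powers without its constant term,
which vanishes. -/
theorem ascPochhammer_eval_eq_sum_Icc {n : ℕ} (hn : 1 ≤ n) (u : ℝ) :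
    (ascPochhammer ℝ n).eval u =
      ∑ k ∈ Finset.Icc 1 n, (ascPochhammer ℝ n).coeff k * u ^ k := by
  have h0 : (ascPochhammer ℝ n).coeff 0 = 0 := by
    rw [Polynomial.coeff_zero_eq_eval_zero, ascPochhammer_eval_zero, if_neg (by lia)]
  rw [Polynomial.eval_eq_sum_range, ascPochhammer_natDegree, Finset.range_eq_Ico,
    Finset.sum_eq_sum_Ico_succ_bot n.succ_pos, h0, zero_mul, zero_add]
  rfl


/-- The Lévy measure of the Negative-Binomial process directed by a Gamma
subordinator: for `β > 0` and `n ≥ 1`,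
`Π_Y(n) = ∫_0^∞ P(X(u)=n)·e^{−u/β} du/u = (αⁿ/n!)·∑_{k=1}^n |s(n,k)|·(k−1)!·(β/(1+Aβ))^k`,
where `P(X(u)=n) = e^{−Au}·[u]_{n↑}·αⁿ/n!`. -/
theorem levy_measure_negBinomial_gamma (α : ℝ) (hα0 : 0 < α) (hα1 : α < 1)
    (A : ℝ) (hA : A = -Real.log (1 - α))
    (β : ℝ) (hβ : 0 < β) (n : ℕ) (hn : 1 ≤ n) :
    ∫ u in Set.Ioi (0 : ℝ),
        (Real.exp (-A * u) * (ascPochhammer ℝ n).eval u * α ^ n / (n.factorial : ℝ)) *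
          Real.exp (-u / β) / u
      = (α ^ n / (n.factorial : ℝ)) *
          ∑ k ∈ Finset.Icc 1 n,
            (ascPochhammer ℝ n).coeff k * ((k - 1).factorial : ℝ) *
              (β / (1 + A * β)) ^ k := by
  have hA0 : 0 < A := hA ▸ neg_pos.mpr (Real.log_neg (by linarith) (by linarith))
  have hr : 0 < A + 1 / β := by positivity
  have hβr : β / (1 + A * β) = 1 / (A + 1 / β) := by field_simp; ring
  calc
    _ = ∫ u in Set.Ioi (0 : ℝ), (α ^ n / (n.factorial : ℝ)) *
          ∑ k ∈ Finset.Icc 1 n, (ascPochhammer ℝ n).coeff k *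
            (u ^ (k - 1) * Real.exp (-((A + 1 / β) * u))) := by
      refine MeasureTheory.setIntegral_congr_fun measurableSet_Ioi fun u hu => ?_
      have hu0 : u ≠ 0 := ne_of_gt hu
      have hexp : Real.exp (-((A + 1 / β) * u)) = Real.exp (-A * u) * Real.exp (-u / β) := by
        rw [← Real.exp_add]
        ring_nf
      have hsum : (ascPochhammer ℝ n).eval u =
          (∑ k ∈ Finset.Icc 1 n, (ascPochhammer ℝ n).coeff k * u ^ (k - 1)) * u := by
        rw [ascPochhammer_eval_eq_sum_Icc hn, Finset.sum_mul]
        refine Finset.sum_congr rfl fun k hk => ?_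
        rw [mul_assoc, pow_sub_one_mul (by grind)]
      simp only [hsum, hexp, ← mul_assoc, ← Finset.sum_mul]
      field_simp
    _ = _ := by
      rw [MeasureTheory.integral_const_mul, MeasureTheory.integral_finsetSum _ fun k _ =>
        (integrableOn_pow_mul_exp_neg_mul_Ioi (k - 1) hr).const_mul _]
      congr 1
      refine Finset.sum_congr rfl fun k hk => ?_
      rw [MeasureTheory.integral_const_mul, integral_pow_mul_exp_neg_mul_Ioi _ hr,
        Nat.sub_add_cancel (Finset.mem_Icc.mp hk).1, hβr, mul_assoc]
end

section
/- For all real t > 0, β > 0 and every natural number n, the transition probability of the subordinated process Y(t) = X(T_β(t)) satisfies P(Y(t)=n) = ∫_0^∞ e^{−Au}·[u]_{n↑}·(α^n/n!) · u^{t−1} e^{−u/β} du/(β^t·Γ(t)) = (α^n/n!) · (1+Aβ)^{−t} · ∑_{k=0}^n |s(n,k)| · [t]_{k↑} · (β/(1+Aβ))^k, where Γ is the Gamma function and the integral is over (0,∞). -/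
theorem Real.Gamma_add_natCast_eq_ascPochhammer_mul {t : ℝ} (ht : 0 < t) (k : ℕ) :
    Real.Gamma (t + k) = (ascPochhammer ℝ k).eval t * Real.Gamma t := by
  induction k with
  | zero => simp
  | succ k ih =>
    rw [Nat.cast_succ, ← add_assoc, Real.Gamma_add_one (by positivity), ih,
      ascPochhammer_succ_eval]
    ring

theorem integrableOn_rpow_mul_exp_neg_mul_Ioi {s r : ℝ} (hs : 0 < s) (hr : 0 < r) :
    MeasureTheory.IntegrableOn (fun u : ℝ => u ^ (s - 1) * Real.exp (-(r * u)))
      (Set.Ioi 0) := by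
  simpa using integrableOn_rpow_mul_exp_neg_mul_rpow (p := 1) (s := s - 1) (b := r)
    (by linarith) one_pos hr

/-- Integrating a polynomial against the unnormalised Gamma density of shape `t` and rate `r`. -/
theorem integral_polynomial_eval_mul_rpow_mul_exp_neg_mul_Ioi {t r : ℝ} (ht : 0 < t)
    (hr : 0 < r) (p : Polynomial ℝ) {N : ℕ} (hN : p.natDegree < N) :
    ∫ u in Set.Ioi (0 : ℝ), p.eval u * (u ^ (t - 1) * Real.exp (-(r * u))) =
      (1 / r) ^ t * Real.Gamma t *
        ∑ k ∈ Finset.range N, p.coeff k * (ascPochhammer ℝ k).eval t * (1 / r) ^ k := by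
  have expand : ∀ u ∈ Set.Ioi (0 : ℝ), p.eval u * (u ^ (t - 1) * Real.exp (-(r * u))) =
      ∑ k ∈ Finset.range N, p.coeff k * (u ^ (t + k - 1) * Real.exp (-(r * u))) := by
    intro u hu
    rw [Polynomial.eval_eq_sum_range' hN, Finset.sum_mul]
    refine Finset.sum_congr rfl fun k _ => ?_
    rw [show t + k - 1 = t - 1 + k by ring, Real.rpow_add_natCast (ne_of_gt hu)]
    ring
  rw [MeasureTheory.setIntegral_congr_fun measurableSet_Ioi expand,
    MeasureTheory.integral_finsetSum _ fun k _ =>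
      (integrableOn_rpow_mul_exp_neg_mul_Ioi (by positivity) hr).const_mul _, Finset.mul_sum]
  refine Finset.sum_congr rfl fun k _ => ?_
  rw [MeasureTheory.integral_const_mul,
    Real.integral_rpow_mul_exp_neg_mul_Ioi (by positivity) hr,
    Real.Gamma_add_natCast_eq_ascPochhammer_mul ht, Real.rpow_add_natCast (by positivity)]
  ring


/-- Transition probability of the subordinated process `Y(t) = X(T_β(t))`:
`P(Y(t)=n) = ∫_0^∞ e^{−Au}·[u]_{n↑}·(αⁿ/n!)·u^{t−1}e^{−u/β} du/(βᵗΓ(t))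
           = (αⁿ/n!)·(1+Aβ)^{−t}·∑_{k=0}^n |s(n,k)|·[t]_{k↑}·(β/(1+Aβ))^k`. -/
theorem transition_probability_negBinomial_gamma (α : ℝ) (hα0 : 0 < α) (hα1 : α < 1)
    (A : ℝ) (hA : A = -Real.log (1 - α))
    (β : ℝ) (hβ : 0 < β) (t : ℝ) (ht : 0 < t) (n : ℕ) :
    ∫ u in Set.Ioi (0 : ℝ),
        (Real.exp (-A * u) * (ascPochhammer ℝ n).eval u * α ^ n / (n.factorial : ℝ)) *
          (u ^ (t - 1) * Real.exp (-u / β)) / (β ^ t * Real.Gamma t)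
      = (α ^ n / (n.factorial : ℝ)) * (1 + A * β) ^ (-t) *
          ∑ k ∈ Finset.range (n + 1),
            (ascPochhammer ℝ n).coeff k * (ascPochhammer ℝ k).eval t *
              (β / (1 + A * β)) ^ k := by
  have hA0 : 0 < A := by
    rw [hA, neg_pos]
    exact Real.log_neg (by linarith) (by linarith)
  have hr : 0 < A + 1 / β := by positivity
  have hinv : 1 / (A + 1 / β) = β / (1 + A * β) := by
    field_simp
    ring
  have hΓ : Real.Gamma t ≠ 0 := (Real.Gamma_pos_of_pos ht).ne'
  have hβt : β ^ t ≠ 0 := (Real.rpow_pos_of_pos hβ t).ne'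
  have hpow : (β / (1 + A * β)) ^ t = β ^ t * (1 + A * β) ^ (-t) := by
    rw [Real.div_rpow hβ.le (by positivity), Real.rpow_neg (by positivity), div_eq_mul_inv]
  have integrand : ∀ u : ℝ,
      (Real.exp (-A * u) * (ascPochhammer ℝ n).eval u * α ^ n / (n.factorial : ℝ)) *
          (u ^ (t - 1) * Real.exp (-u / β)) / (β ^ t * Real.Gamma t) =
        α ^ n / (n.factorial : ℝ) / (β ^ t * Real.Gamma t) *
          ((ascPochhammer ℝ n).eval u *
            (u ^ (t - 1) * Real.exp (-((A + 1 / β) * u)))) := by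
    intro u
    rw [show -((A + 1 / β) * u) = -A * u + -u / β by ring, Real.exp_add]
    ring
  simp_rw [integrand]
  rw [MeasureTheory.integral_const_mul,
    integral_polynomial_eval_mul_rpow_mul_exp_neg_mul_Ioi ht hr _ (N := n + 1)
      (by rw [ascPochhammer_natDegree]; exact n.lt_succ_self), hinv, hpow]
  field_simp
end

section
/- For every real β > 0, define Π_Y(n) = (α^n/n!) · ∑_{k=1}^n |s(n,k)| · (k−1)! · (β/(1+Aβ))^k for n ≥ 1. Then the series ∑_{n=1}^∞ Π_Y(n) converges and its sum (the total mass of the Lévy measure of the subordinated process Y) equals log(1+Aβ). -/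
theorem coeff_ascPochhammer_nonneg (n k : ℕ) : 0 ≤ (ascPochhammer ℝ n).coeff k := by
  rw [← ascPochhammer_map (Nat.castRingHom ℝ) n, Polynomial.coeff_map]
  exact Nat.cast_nonneg _

theorem coeff_ascPochhammer_eq_zero_of_lt {n k : ℕ} (h : n < k) :
    (ascPochhammer ℝ n).coeff k = 0 :=
  Polynomial.coeff_eq_zero_of_natDegree_lt (by rwa [ascPochhammer_natDegree])

/-- The negative binomial series `∑ x(x+1)⋯(x+n-1) αⁿ/n! = (1-α)⁻ˣ`. -/
theorem hasSum_ascPochhammer_eval {α : ℝ} (hα : |α| < 1) (x : ℝ) :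
    HasSum (fun n : ℕ => α ^ n / (n.factorial : ℝ) * (ascPochhammer ℝ n).eval x)
      (Real.exp (-Real.log (1 - α) * x)) := by
  have h := (Real.one_div_one_sub_rpow_hasFPowerSeriesOnBall_zero x).hasSum (y := α)
    (by simpa [enorm_eq_nnnorm, ← NNReal.coe_lt_coe] using hα)
  have hpos : 0 < 1 - α := by linarith [(abs_lt.mp hα).2]
  convert! h using 1
  · funext n
    have hm := Ring.factorial_nsmul_multichoose_eq_ascPochhammer x n
    rw [Polynomial.ascPochhammer_smeval_eq_eval, nsmul_eq_mul] at hm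
    have hn : (n.factorial : ℝ) ≠ 0 := by positivity
    have hc : Ring.choose (x + n - 1) n = Ring.multichoose x n := by
      rw [Ring.choose]
      congr 1
      ring
    simp only [FormalMultilinearSeries.ofScalars_apply_eq, hc, ← hm, smul_eq_mul]
    field_simp
  · rw [zero_add, Real.rpow_def_of_pos hpos, one_div, ← Real.exp_neg, neg_mul]

theorem coeff_ascPochhammer_mul_nonneg {α b : ℝ} (hα : 0 ≤ α) (hb : 0 ≤ b) (n k : ℕ) :
    0 ≤ α ^ n / (n.factorial : ℝ) * (ascPochhammer ℝ n).coeff k * b :=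
  mul_nonneg (mul_nonneg (by positivity) (coeff_ascPochhammer_nonneg n k)) hb

theorem summable_prod_of_nonneg_of_hasSum_rows {ι κ : Type*} {f : ι → κ → ℝ} {r : ι → ℝ}
    (hf : ∀ i k, 0 ≤ f i k) (hr : ∀ i, HasSum (f i) (r i)) (hs : Summable r) :
    Summable fun p : ι × κ => f p.1 p.2 :=
  (summable_prod_of_nonneg fun p => hf p.1 p.2).mpr
    ⟨fun i => (hr i).summable, by simpa only [(hr _).tsum_eq] using hs⟩

/-- Interchange of summation for an absolutely convergent double series. -/
theorem hasSum_columns_of_hasSum_rows {ι κ : Type*} {f : ι → κ → ℝ} {r : ι → ℝ} {c : κ → ℝ}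
    {s : ℝ} (hf : Summable fun p : ι × κ => f p.1 p.2) (hr : ∀ i, HasSum (f i) (r i))
    (hc : ∀ k, HasSum (fun i => f i k) (c k)) (hs : HasSum r s) : HasSum c s := by
  have htot := (hf.hasSum.prod_fiberwise hr).unique hs
  have h : HasSum (fun p : κ × ι => f p.2 p.1) s :=
    by
    simpa [Function.comp_def, htot] using (Equiv.prodComm κ ι).hasSum_iff.mpr hf.hasSum
  exact h.prod_fiberwise hc

theorem hasSum_coeff_ascPochhammer_mul (a : ℝ) (d : ℕ → ℝ) (n : ℕ) :
    HasSum (fun k => a * (ascPochhammer ℝ n).coeff k * d k)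
      (a * ∑ k ∈ Finset.range (n + 1), (ascPochhammer ℝ n).coeff k * d k) := by
  simp only [mul_assoc]
  refine (hasSum_sum_of_ne_finset_zero fun k hk => ?_).mul_left a
  rw [coeff_ascPochhammer_eq_zero_of_lt (by simpa [Nat.lt_succ_iff] using hk), zero_mul]

theorem hasSum_coeff_ascPochhammer_mul_pow (a x : ℝ) (n : ℕ) :
    HasSum (fun k => a * (ascPochhammer ℝ n).coeff k * x ^ k)
      (a * (ascPochhammer ℝ n).eval x) := by
  simpa only [Polynomial.eval_eq_sum_range, ascPochhammer_natDegree] using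
    hasSum_coeff_ascPochhammer_mul a (x ^ ·) n

theorem summable_prod_coeff_ascPochhammer {α : ℝ} (hα0 : 0 ≤ α) (hα1 : α < 1) (x : ℝ) :
    Summable fun p : ℕ × ℕ =>
      α ^ p.1 / (p.1.factorial : ℝ) * (ascPochhammer ℝ p.1).coeff p.2 * x ^ p.2 := by
  have hα : |α| < 1 := by rwa [abs_of_nonneg hα0]
  have habs : Summable fun p : ℕ × ℕ =>
      α ^ p.1 / (p.1.factorial : ℝ) * (ascPochhammer ℝ p.1).coeff p.2 * |x| ^ p.2 :=
    summable_prod_of_nonneg_of_hasSum_rows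
      (f := fun n k => α ^ n / (n.factorial : ℝ) * (ascPochhammer ℝ n).coeff k * |x| ^ k)
      (fun n k => coeff_ascPochhammer_mul_nonneg hα0 (pow_nonneg (abs_nonneg x) k) n k)
      (fun n => hasSum_coeff_ascPochhammer_mul_pow _ _ n)
      (hasSum_ascPochhammer_eval hα |x|).summable
  refine habs.of_norm_bounded fun p => le_of_eq ?_
  rw [norm_mul, norm_pow, Real.norm_eq_abs x, Real.norm_of_nonneg
    (mul_nonneg (by positivity) (coeff_ascPochhammer_nonneg _ _))]

/-- The exponential generating function of a column of unsigned Stirling numbers of the first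
kind. -/
theorem hasSum_pow_div_factorial_mul_coeff_ascPochhammer {α : ℝ} (hα0 : 0 ≤ α) (hα1 : α < 1)
    (k : ℕ) :
    HasSum (fun n : ℕ => α ^ n / (n.factorial : ℝ) * (ascPochhammer ℝ n).coeff k)
      ((-Real.log (1 - α)) ^ k / (k.factorial : ℝ)) := by
  have hα : |α| < 1 := by rwa [abs_of_nonneg hα0]
  set A := -Real.log (1 - α)
  have hcol (k : ℕ) : Summable fun n : ℕ =>
      α ^ n / (n.factorial : ℝ) * (ascPochhammer ℝ n).coeff k := by
    have h := (summable_prod_coeff_ascPochhammer hα0 hα1 1).prod_symm.prod_factor k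
    simpa only [Prod.swap_prod_mk, one_pow, mul_one] using h
  set g : ℕ → ℝ := fun k => ∑' n : ℕ, α ^ n / (n.factorial : ℝ) * (ascPochhammer ℝ n).coeff k
  have hgsum (x : ℝ) : HasSum (fun k => x ^ k * g k) (Real.exp (A * x)) := by
    have h := hasSum_columns_of_hasSum_rows
      (f := fun n k => α ^ n / (n.factorial : ℝ) * (ascPochhammer ℝ n).coeff k * x ^ k)
      (summable_prod_coeff_ascPochhammer hα0 hα1 x)
      (fun n => hasSum_coeff_ascPochhammer_mul_pow _ _ n)
      (fun k => (hcol k).hasSum.mul_right (x ^ k))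
      (hasSum_ascPochhammer_eval hα x)
    simpa only [mul_comm (_ ^ _) (g _)] using h
  have hesum (x : ℝ) : HasSum (fun k : ℕ => x ^ k * (A ^ k / (k.factorial : ℝ)))
      (Real.exp (A * x)) := by
    have h := NormedSpace.expSeries_div_hasSum_exp (A * x)
    rw [← Real.exp_eq_exp_ℝ] at h
    convert! h using 2
    rw [mul_pow]
    ring
  have hseries {c : ℕ → ℝ} (hc : ∀ x, HasSum (fun k => x ^ k * c k) (Real.exp (A * x))) :
      HasFPowerSeriesAt (fun x => Real.exp (A * x)) (.ofScalars ℝ c) 0 := by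
    rw [hasFPowerSeriesAt_iff]
    exact .of_forall fun x => by
      simpa [FormalMultilinearSeries.coeff_ofScalars] using hc x
  have heq := congrArg (fun p => p.coeff k)
    ((hseries hgsum).eq_formalMultilinearSeries (hseries hesum))
  simp only [FormalMultilinearSeries.coeff_ofScalars] at heq
  exact heq ▸ (hcol k).hasSum

/-- The total mass of the Lévy measure
`Π_Y(n) = (αⁿ/n!)·∑_{k=1}^n |s(n,k)|·(k−1)!·(β/(1+Aβ))^k` (`n ≥ 1`; the `n = 0` term is zero)
of the subordinated process `Y` equals `log(1+Aβ)`. -/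
theorem levy_measure_total_mass_Y (α : ℝ) (hα0 : 0 < α) (hα1 : α < 1)
    (A : ℝ) (hA : A = -Real.log (1 - α)) (β : ℝ) (hβ : 0 < β) :
    HasSum
      (fun n : ℕ =>
        (α ^ n / (n.factorial : ℝ)) *
          ∑ k ∈ Finset.Icc 1 n,
            (ascPochhammer ℝ n).coeff k * ((k - 1).factorial : ℝ) *
              (β / (1 + A * β)) ^ k)
      (Real.log (1 + A * β)) := by
  have h1A : 0 < A := by
    rw [hA, neg_pos]
    exact Real.log_neg (by linarith) (by linarith)
  have hpos : 0 < 1 + A * β := by positivity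
  set c := β / (1 + A * β) with hc
  have hc0 : 0 < c := by positivity
  have hAc : 1 - A * c = (1 + A * β)⁻¹ := by
    rw [hc]
    field_simp
    ring
  have hAc1 : |A * c| < 1 := by
    rw [abs_of_pos (by positivity)]
    linarith [inv_pos.mpr hpos]
  let d : ℕ → ℝ := fun k => if k = 0 then 0 else ((k - 1).factorial : ℝ) * c ^ k
  have hd (k : ℕ) : 0 ≤ d k := by
    dsimp only [d]
    split_ifs <;> positivity
  have hcol (k : ℕ) : HasSum
      (fun n : ℕ => α ^ n / (n.factorial : ℝ) * (ascPochhammer ℝ n).coeff k * d k)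
      (A ^ k / (k.factorial : ℝ) * d k) :=
    hA ▸ (hasSum_pow_div_factorial_mul_coeff_ascPochhammer hα0.le hα1 k).mul_right (d k)
  have hlog : HasSum (fun k : ℕ => A ^ k / (k.factorial : ℝ) * d k)
      (Real.log (1 + A * β)) := by
    have h := Real.hasSum_pow_div_log_of_abs_lt_one hAc1
    rw [hAc, Real.log_inv, neg_neg] at h
    rw [← hasSum_nat_add_iff' 1]
    convert! h using 1
    · funext k
      have hk : (k.factorial : ℝ) ≠ 0 := by positivity
      simp only [d, Nat.add_eq_zero_iff, one_ne_zero, and_false, if_false, Nat.add_sub_cancel,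
        Nat.factorial_succ, Nat.cast_mul, Nat.cast_add, Nat.cast_one, mul_pow]
      field_simp
    · simp [d]
  have hs : Summable fun p : ℕ × ℕ =>
      α ^ p.2 / (p.2.factorial : ℝ) * (ascPochhammer ℝ p.2).coeff p.1 * d p.1 :=
    summable_prod_of_nonneg_of_hasSum_rows
      (f := fun k n => α ^ n / (n.factorial : ℝ) * (ascPochhammer ℝ n).coeff k * d k)
      (fun k n => coeff_ascPochhammer_mul_nonneg hα0.le (hd k) n k) hcol hlog.summable
  have h := hasSum_columns_of_hasSum_rows
    (f := fun k n => α ^ n / (n.factorial : ℝ) * (ascPochhammer ℝ n).coeff k * d k) hs hcol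
    (fun n => hasSum_coeff_ascPochhammer_mul (α ^ n / (n.factorial : ℝ)) d n) hlog
  convert h using 3 with n
  rw [Finset.range_eq_Ico, Finset.sum_eq_sum_Ico_succ_bot n.succ_pos]
  simp only [d, if_true, mul_zero, zero_add]
  refine Finset.sum_congr (by ext; simp) fun k hk => ?_
  rw [if_neg (by simp at hk; omega), mul_assoc]
end

section
/- For every real number α with 0 < α < 1, writing A = −log(1−α), the chain of strict inequalities α/(A(1−α)) − 1 < (A−α)/(A(1−α)) < α/(1−α) < (A/(A−α))·(α/(1−α) − A) holds. (These four quantities are the values at 0 of the derivatives of the Bernstein functions ψ_L, ψ_Y, ψ_X, ψ_Z, i.e. the mean jump sizes E[L(1)], E[Y(1)], E[X(1)], E[Z(1)], under the 'Selection A' parameters β = (A−α)/(Aα) and b = A²/(A−α), for which the total masses of the Lévy measures satisfy θ_L = θ_Y and θ_X = θ_Z.) -/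
/-- Selection A: For `0 < α < 1` and `A = −log(1−α)`, the chain of strict
inequalities `α/(A(1−α)) − 1 < (A−α)/(A(1−α)) < α/(1−α) < (A/(A−α))·(α/(1−α) − A)` holds
(the mean jump sizes `ψ'_L(0) < ψ'_Y(0) < ψ'_X(0) < ψ'_Z(0)`). -/
theorem selectionA_inequalities (α : ℝ) (hα0 : 0 < α) (hα1 : α < 1)
    (A : ℝ) (hA : A = -Real.log (1 - α)) :
    α / (A * (1 - α)) - 1 < (A - α) / (A * (1 - α)) ∧
      (A - α) / (A * (1 - α)) < α / (1 - α) ∧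
        α / (1 - α) < (A / (A - α)) * (α / (1 - α) - A) := by
  have hq : 0 < 1 - α := sub_pos.2 hα1
  have hexp : Real.exp (-A) = 1 - α := by rw [hA, neg_neg, Real.exp_log hq]
  have hαA : α < A := by
    have := Real.log_lt_sub_one_of_pos hq (by linarith)
    linarith
  have hA0 : 0 < A := hα0.trans hαA
  have lower : 2 * α < A * (2 - α) := by
    have h := Real.lt_log_one_add_of_pos (div_pos hα0 hq)
    have hlog : Real.log (1 + α / (1 - α)) = A := by
      rw [hA, ← Real.log_inv]
      congr 1
      field_simp
      ring
    have hfrac : 2 * (α / (1 - α)) / (α / (1 - α) + 2) = 2 * α / (2 - α) := by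
      have : α / (1 - α) + 2 = (2 - α) / (1 - α) := by
        field_simp
        ring
      rw [this]
      field_simp
    rwa [hlog, hfrac, div_lt_iff₀ (by linarith)] at h
  have upper : A ^ 2 * (1 - α) < α ^ 2 := by
    have h := Real.self_lt_sinh_iff.2 (half_pos hA0)
    rw [Real.sinh_eq] at h
    have hmul : Real.exp (A / 2) * Real.exp (-(A / 2)) = 1 := by
      rw [← Real.exp_add, add_neg_cancel, Real.exp_zero]
    have hsq : Real.exp (-(A / 2)) ^ 2 = 1 - α := by
      rw [← hexp, sq, ← Real.exp_add]
      congr 1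
      ring
    have hpos := Real.exp_pos (-(A / 2))
    have hlt : A * Real.exp (-(A / 2)) < α := by nlinarith
    calc A ^ 2 * (1 - α) = (A * Real.exp (-(A / 2))) ^ 2 := by rw [← hsq]; ring
      _ < α ^ 2 := by gcongr
  have upper' : A * (1 - α) < α := by
    nlinarith
  have hd : 0 < A - α := sub_pos.2 hαA
  refine ⟨?_, ?_, ?_⟩
  · rw [div_sub_one (by positivity), div_lt_div_iff_of_pos_right (by positivity)]
    linarith
  · rw [div_lt_div_iff₀ (by positivity) hq]
    nlinarith
  · rw [div_sub' hq.ne', div_mul_div_comm, div_lt_div_iff₀ hq (by positivity)]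
    nlinarith
end

section
/- For every real number α with 0 < α < 1, writing A = −log(1−α), one has α − A(1−α) > 0, and the chain of strict inequalities log(2 − A(1−α)/α) < log(A/α) < α(A−α)/(Aα − A + α) < A holds. (These four quantities are the total masses ψ_Y(∞), ψ_L(∞), ψ_Z(∞), ψ_X(∞) of the Lévy measures of the processes Y, L, Z, X under the 'Selection B' parameters β = 1/A − (1−α)/α and b = Aα/(α − A(1−α)), for which the mean jump sizes satisfy ψ'_L(0) = ψ'_Y(0) and ψ'_Z(0) = ψ'_X(0).) -/
/-- The bound `A < 2 sinh (A / 2)` in exponential form. -/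
theorem sq_mul_exp_neg_lt_one_sub_exp_neg_sq {A : ℝ} (hA : 0 < A) :
    A ^ 2 * Real.exp (-A) < (1 - Real.exp (-A)) ^ 2 := by
  have h_sinh := Real.self_lt_sinh_iff.mpr (half_pos hA)
  rw [Real.sinh_eq] at h_sinh
  have hs : 0 < Real.exp (-(A / 2)) := Real.exp_pos _
  have h_sq : Real.exp (-A) = Real.exp (-(A / 2)) ^ 2 := by
    rw [← Real.exp_nat_mul]; congr 1; push_cast; ring
  have h_inv : Real.exp (A / 2) * Real.exp (-(A / 2)) = 1 := by
    rw [← Real.exp_add, add_neg_cancel, Real.exp_zero]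
  have h_lt : A * Real.exp (-(A / 2)) < 1 - Real.exp (-(A / 2)) ^ 2 := by
    nlinarith
  rw [h_sq, ← mul_pow]
  exact pow_lt_pow_left₀ h_lt (by positivity) two_ne_zero

/-- A lower bound for `-log (1 - x)`, equivalent to `tanh (A / 2) < A / 2`. -/
theorem two_mul_div_lt_neg_log_one_sub {x : ℝ} (hx0 : 0 < x) (hx1 : x < 1) :
    2 * x / (2 - x) < -Real.log (1 - x) := by
  have hq : 0 < 1 - x := sub_pos.mpr hx1
  have h2 : 0 < 2 - x := by linarith
  have h := Real.lt_log_one_add_of_pos (div_pos hx0 hq)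
  have h_left : 2 * (x / (1 - x)) / (x / (1 - x) + 2) = 2 * x / (2 - x) := by
    have h_add : x / (1 - x) + 2 = (2 - x) / (1 - x) := by field_simp; ring
    rw [h_add]; field_simp
  have h_right : 1 + x / (1 - x) = (1 - x)⁻¹ := by field_simp; ring
  rwa [h_left, h_right, Real.log_inv] at h

/-- Selection B: For `0 < α < 1` and `A = −log(1−α)`: `α − A(1−α) > 0` and
`log(2 − A(1−α)/α) < log(A/α) < α(A−α)/(Aα − A + α) < A` (the total masses
`ψ_Y(∞) < ψ_L(∞) < ψ_Z(∞) < ψ_X(∞)`). -/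
theorem selectionB_inequalities (α : ℝ) (hα0 : 0 < α) (hα1 : α < 1)
    (A : ℝ) (hA : A = -Real.log (1 - α)) :
    0 < α - A * (1 - α) ∧
      Real.log (2 - A * (1 - α) / α) < Real.log (A / α) ∧
        Real.log (A / α) < α * (A - α) / (A * α - A + α) ∧
          α * (A - α) / (A * α - A + α) < A := by
  have hq : 0 < 1 - α := sub_pos.mpr hα1
  have h_exp : Real.exp (-A) = 1 - α := by rw [hA, neg_neg, Real.exp_log hq]
  have hαA : α < A := by
    have := Real.log_lt_sub_one_of_pos hq (by linarith)
    linarith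
  have hA0 : 0 < A := hα0.trans hαA
  have h_den : 0 < α - A * (1 - α) := by
    have h := Real.add_one_lt_exp hA0.ne'
    have h_inv : Real.exp A * (1 - α) = 1 := by
      rw [← h_exp, ← Real.exp_add, add_neg_cancel, Real.exp_zero]
    nlinarith
  have h_den' : 0 < A * α - A + α := by linarith
  refine ⟨h_den, ?_, ?_, ?_⟩
  · have h_tanh := two_mul_div_lt_neg_log_one_sub hα0 hα1
    rw [← hA, div_lt_iff₀ (by linarith)] at h_tanh
    have h_lt_one : A * (1 - α) / α < 1 := (div_lt_one hα0).mpr (by linarith)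
    refine Real.log_lt_log (by linarith) ?_
    rw [sub_lt_iff_lt_add, ← add_div, lt_div_iff₀ hα0]
    linarith
  · calc
      Real.log (A / α) < A / α - 1 :=
        Real.log_lt_sub_one_of_pos (div_pos hA0 hα0) ((one_lt_div hα0).mpr hαA).ne'
      _ = (A - α) / α := by rw [sub_div, div_self hα0.ne']
      _ < α * (A - α) / (A * α - A + α) := by
        rw [div_lt_div_iff₀ hα0 h_den']
        have h_gap : A * α - A + α < α * α := by nlinarith
        nlinarith [mul_lt_mul_of_pos_left h_gap (sub_pos.mpr hαA)]
  · rw [div_lt_iff₀ h_den']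
    have h := sq_mul_exp_neg_lt_one_sub_exp_neg_sq hA0
    rw [h_exp] at h
    linarith
end
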